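/- arXiv:1702.00201 — 3 statements merged into one kernel-verified Lean document; each statement's English description precedes it below -/
import Mathlib

section
/- On the set 𝕍 of Young measures, weak convergence implies stable convergence, uniformly in the time truncation: if μ_n, μ ∈ 𝕍 and μ_n → μ weakly, then for every bounded Borel measurable function f : [0,T] × A → ℝ such that a ↦ f(t,a) is continuous for every t ∈ [0,T], one has sup_{t ∈ [0,T]} | ∫_{[0,t] × A} f dμ_n − ∫_{[0,t] × A} f dμ | → 0 as n → ∞. In particular, ∫_{[0,T] × A} f dμ_n → ∫_{[0,T] × A} f dμ for every such bounded measurable-in-t, continuous-in-a test function f. -/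
open MeasureTheory Filter Topology

namespace YoungAux

lemma measurable_toC {A : Type*} [MetricSpace A] [CompactSpace A] [Nonempty A]
    (F : ℝ → C(A, ℝ)) (hF : ∀ a, Measurable fun t => F t a) :
    @Measurable _ _ _ (borel C(A, ℝ)) F := by
  letI : MeasurableSpace C(A, ℝ) := borel _
  haveI : BorelSpace C(A, ℝ) := ⟨rfl⟩
  have hd : ∀ g : C(A, ℝ), Measurable fun t => dist (F t) g := by
    intro g
    apply measurable_of_Iic
    intro r
    have : (fun t => dist (F t) g) ⁻¹' Set.Iic r
        = ⋂ k : ℕ, {t | dist (F t (TopologicalSpace.denseSeq A k))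
            (g (TopologicalSpace.denseSeq A k)) ≤ r} := by
      ext t
      simp only [Set.mem_preimage, Set.mem_Iic, Set.mem_iInter, Set.mem_setOf_eq]
      rw [ContinuousMap.dist_le_iff_of_nonempty]
      constructor
      · intro h k
        exact h _
      · intro h x
        have hcl : IsClosed {x | dist (F t x) (g x) ≤ r} :=
          isClosed_le (by fun_prop) continuous_const
        have := (TopologicalSpace.denseRange_denseSeq A).closure_eq ▸
          (closure_minimal (t := {x | dist (F t x) (g x) ≤ r})
            (s := Set.range (TopologicalSpace.denseSeq A))
            (by rintro _ ⟨k, rfl⟩; exact h k) hcl)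
        exact this (Set.mem_univ x)
    rw [this]
    refine MeasurableSet.iInter fun k => ?_
    exact measurableSet_le ((hF _).dist measurable_const) measurable_const
  refine measurable_of_isOpen fun U hU => ?_
  have h1 : ∀ x : U, ∃ r > 0, Metric.ball (x : C(A, ℝ)) r ⊆ U := fun x =>
    Metric.isOpen_iff.1 hU x x.2
  choose r hr hrU using h1
  obtain ⟨T, hTc, hT⟩ := TopologicalSpace.isOpen_iUnion_countable
    (fun x : U => Metric.ball (x : C(A, ℝ)) (r x)) (fun x => Metric.isOpen_ball)
  have hUe : U = ⋃ x ∈ T, Metric.ball (x : C(A, ℝ)) (r x) := by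
    rw [hT]
    apply Set.Subset.antisymm
    · intro x hx
      exact Set.mem_iUnion.2 ⟨⟨x, hx⟩, Metric.mem_ball_self (hr _)⟩
    · exact Set.iUnion_subset hrU
  rw [hUe, Set.preimage_iUnion₂]
  refine MeasurableSet.biUnion hTc fun x _ => ?_
  exact measurableSet_lt (hd x) measurable_const

lemma main {A : Type*} [MetricSpace A] [CompactSpace A] [Nonempty A]
    [MeasurableSpace A] [BorelSpace A]
    (T : ℝ)
    (μ : ℕ → FiniteMeasure (ℝ × A)) (μlim : FiniteMeasure (ℝ × A))
    (hproj : ∀ n, ((μ n : Measure (ℝ × A)).map Prod.fst)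
      = volume.restrict (Set.Icc 0 T))
    (hprojlim : ((μlim : Measure (ℝ × A)).map Prod.fst) = volume.restrict (Set.Icc 0 T))
    (hconv : Tendsto μ atTop (𝓝 μlim))
    (f : ℝ × A → ℝ) (hfm : Measurable f)
    (C : ℝ) (hfb : ∀ x, |f x| ≤ C)
    (hfc : ∀ t, Continuous fun a => f (t, a)) :
    Tendsto (fun n => ∫ x, f x ∂(μ n : Measure (ℝ × A))) atTop
      (𝓝 (∫ x, f x ∂(μlim : Measure (ℝ × A)))) := by
  letI : MeasurableSpace C(A, ℝ) := borel _
  haveI : BorelSpace C(A, ℝ) := ⟨rfl⟩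
  let F : ℝ → C(A, ℝ) := fun t => ⟨fun a => f (t, a), hfc t⟩
  have hFm : Measurable F := measurable_toC F fun a => hfm.comp (by fun_prop)
  have hFi : Integrable F (volume.restrict (Set.Icc 0 T)) := by
    refine Integrable.of_bound hFm.stronglyMeasurable.aestronglyMeasurable C
      (ae_of_all _ fun t => ?_)
    rw [ContinuousMap.norm_le_of_nonempty]
    exact fun a => hfb (t, a)
  rw [Metric.tendsto_atTop]
  intro ε hε
  obtain ⟨G, hG, hGi⟩ := hFi.exists_boundedContinuous_integral_sub_le
    (show 0 < ε / 4 by positivity)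
  let g : BoundedContinuousFunction (ℝ × A) ℝ :=
    BoundedContinuousFunction.ofNormedAddCommGroup (fun x => G x.1 x.2)
      (by fun_prop) ‖G‖ (fun x => ((G x.1).norm_coe_le_norm x.2).trans (G.norm_coe_le_norm _))
  have key : ∀ ν : FiniteMeasure (ℝ × A),
      ((ν : Measure (ℝ × A)).map Prod.fst) = volume.restrict (Set.Icc 0 T) →
      |(∫ x, f x ∂(ν : Measure (ℝ × A))) - ∫ x, g x ∂(ν : Measure (ℝ × A))| ≤ ε / 4 := by
    intro ν hν
    have hfi : Integrable f (ν : Measure (ℝ × A)) :=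
      Integrable.of_bound hfm.aestronglyMeasurable C (ae_of_all _ hfb)
    have hgi : Integrable g (ν : Measure (ℝ × A)) := g.integrable _
    have hsub : Integrable (fun t => ‖F t - G t‖) ((ν : Measure (ℝ × A)).map Prod.fst) := by
      rw [hν]; exact (hFi.sub hGi).norm
    rw [← integral_sub hfi hgi]
    calc _ ≤ ∫ x, |f x - g x| ∂(ν : Measure (ℝ × A)) := abs_integral_le_integral_abs
      _ ≤ ∫ x, ‖F x.1 - G x.1‖ ∂(ν : Measure (ℝ × A)) := by
        refine integral_mono (hfi.sub hgi).abs (hsub.comp_measurable measurable_fst) fun x => ?_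
        exact (F x.1 - G x.1).norm_coe_le_norm x.2
      _ = ∫ t, ‖F t - G t‖ ∂((ν : Measure (ℝ × A)).map Prod.fst) :=
        (integral_map measurable_fst.aemeasurable hsub.aestronglyMeasurable).symm
      _ ≤ ε / 4 := by rw [hν]; exact hG
  obtain ⟨N, hN⟩ := Metric.tendsto_atTop.1
    (FiniteMeasure.tendsto_iff_forall_integral_tendsto.1 hconv g) (ε / 4) (by positivity)
  refine ⟨N, fun n hn => ?_⟩
  have h1 := abs_le.1 (key (μ n) (hproj n))
  have h2 := abs_le.1 (key μlim hprojlim)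
  have h3 := hN n hn
  rw [Real.dist_eq, abs_lt] at h3 ⊢
  constructor <;> linarith [h1.1, h1.2, h2.1, h2.2, h3.1, h3.2]

lemma lip {A : Type*} [MetricSpace A] [CompactSpace A] [MeasurableSpace A] [BorelSpace A]
    (T : ℝ) (ν : FiniteMeasure (ℝ × A))
    (hν : ((ν : Measure (ℝ × A)).map Prod.fst) = volume.restrict (Set.Icc 0 T))
    (f : ℝ × A → ℝ) (hfm : Measurable f)
    (C : ℝ) (hC : 0 ≤ C) (hfb : ∀ x, |f x| ≤ C) (s t : ℝ) (hst : s ≤ t) :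
    |(∫ x in {p : ℝ × A | p.1 ≤ t}, f x ∂(ν : Measure (ℝ × A))) -
          ∫ x in {p : ℝ × A | p.1 ≤ s}, f x ∂(ν : Measure (ℝ × A))| ≤ C * (t - s) := by
  have hfi : Integrable f (ν : Measure (ℝ × A)) :=
    Integrable.of_bound hfm.aestronglyMeasurable C (ae_of_all _ hfb)
  have hms : ∀ r : ℝ, MeasurableSet {p : ℝ × A | p.1 ≤ r} := fun r =>
    measurableSet_le measurable_fst measurable_const
  have hss : {p : ℝ × A | p.1 ≤ s} ⊆ {p : ℝ × A | p.1 ≤ t} :=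
    fun p (hp : p.1 ≤ s) => hp.trans hst
  rw [← setIntegral_sdiff (hms s) hfi.integrableOn hss]
  refine (norm_setIntegral_le_of_norm_le_const (f := f) (C := C) (measure_lt_top _ _)
    (fun x _ => hfb x)).trans ?_
  refine mul_le_mul_of_nonneg_left ?_ hC
  have he : ({p : ℝ × A | p.1 ≤ t} \ {p : ℝ × A | p.1 ≤ s}) = Prod.fst ⁻¹' (Set.Ioc s t) := by
    ext p; simp [and_comm]
  rw [he, ← map_measureReal_apply measurable_fst measurableSet_Ioc, hν]
  calc _ ≤ (volume : Measure ℝ).real (Set.Ioc s t) := by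
        apply ENNReal.toReal_mono (by simp)
        exact Measure.restrict_apply_le _ _
    _ = t - s := by simp [hst]

lemma uniform {A : Type*} [MetricSpace A] [CompactSpace A] [Nonempty A]
    [MeasurableSpace A] [BorelSpace A]
    (T : ℝ)
    (μ : ℕ → FiniteMeasure (ℝ × A)) (μlim : FiniteMeasure (ℝ × A))
    (hproj : ∀ n, ((μ n : Measure (ℝ × A)).map Prod.fst)
      = volume.restrict (Set.Icc 0 T))
    (hprojlim : ((μlim : Measure (ℝ × A)).map Prod.fst) = volume.restrict (Set.Icc 0 T))
    (hconv : Tendsto μ atTop (𝓝 μlim))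
    (f : ℝ × A → ℝ) (hfm : Measurable f)
    (C : ℝ) (hC : 0 ≤ C) (hfb : ∀ x, |f x| ≤ C)
    (hfc : ∀ t, Continuous fun a => f (t, a)) :
    Tendsto (fun n => ⨆ t : Set.Icc (0:ℝ) T,
        |(∫ x in {p : ℝ × A | p.1 ≤ (t : ℝ)}, f x ∂(μ n : Measure (ℝ × A))) -
          ∫ x in {p : ℝ × A | p.1 ≤ (t : ℝ)}, f x ∂(μlim : Measure (ℝ × A))|)
      atTop (𝓝 0) := by
  have hms : ∀ r : ℝ, MeasurableSet {p : ℝ × A | p.1 ≤ r} := fun r =>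
    measurableSet_le measurable_fst measurable_const
  let Φ : ℕ → Set.Icc (0:ℝ) T → ℝ := fun n t =>
    ∫ x in {p : ℝ × A | p.1 ≤ (t : ℝ)}, f x ∂(μ n : Measure (ℝ × A))
  let φ : Set.Icc (0:ℝ) T → ℝ := fun t =>
    ∫ x in {p : ℝ × A | p.1 ≤ (t : ℝ)}, f x ∂(μlim : Measure (ℝ × A))
  have hpt : Tendsto Φ atTop (𝓝 φ) := by
    rw [tendsto_pi_nhds]
    intro t
    simp only [Φ, φ, ← integral_indicator (hms _)]
    refine main T μ μlim hproj hprojlim hconv _ (hfm.indicator (hms _)) C ?_ ?_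
    · intro x
      by_cases hx : x ∈ {p : ℝ × A | p.1 ≤ (t : ℝ)}
      · rw [Set.indicator_of_mem hx]; exact hfb x
      · rw [Set.indicator_of_notMem hx]; simpa using hC
    · intro s
      by_cases hs : s ≤ (t : ℝ)
      · simpa [Set.indicator, hs] using hfc s
      · simpa [Set.indicator, hs] using continuous_const
  have hlip : ∀ n, LipschitzWith ⟨C, hC⟩ (Φ n) := by
    intro n
    refine LipschitzWith.of_dist_le_mul fun s t => ?_
    rw [Real.dist_eq, Subtype.dist_eq, Real.dist_eq]
    change |Φ n s - Φ n t| ≤ C * _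
    rcases le_total (s : ℝ) t with h | h
    · rw [abs_sub_comm, abs_sub_comm (s : ℝ), abs_of_nonneg (sub_nonneg.2 h)]
      exact lip T (μ n) (hproj n) f hfm C hC hfb s t h
    · rw [abs_of_nonneg (sub_nonneg.2 h)]
      exact lip T (μ n) (hproj n) f hfm C hC hfb t s h
  have heq := (LipschitzWith.uniformEquicontinuous Φ ⟨C, hC⟩ hlip).equicontinuous
  have hu := (heq.tendsto_uniformFun_iff_pi atTop φ).2 hpt
  rw [UniformFun.tendsto_iff_tendstoUniformly] at hu
  have hu' : TendstoUniformly Φ φ atTop := hu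
  rw [Metric.tendstoUniformly_iff] at hu'
  rw [Metric.tendsto_atTop]
  intro ε hε
  obtain ⟨N, hN⟩ := eventually_atTop.1 (hu' (ε / 2) (by positivity))
  refine ⟨N, fun n hn => ?_⟩
  rw [Real.dist_eq, sub_zero, abs_of_nonneg (Real.iSup_nonneg fun _ => abs_nonneg _)]
  refine lt_of_le_of_lt (Real.iSup_le (fun t => ?_) (by positivity)) (half_lt_self hε)
  have := hN n hn t
  rw [dist_comm, Real.dist_eq] at this
  exact this.le

end YoungAux

/-- On the set 𝕍 of Young measures, weak convergence implies stable
convergence, uniformly in the time truncation: if μ_n → μ weakly in 𝕍, then for every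
bounded Borel function f on [0,T] × A which is continuous in the action variable,
sup_{t ∈ [0,T]} |∫_{[0,t]×A} f dμ_n − ∫_{[0,t]×A} f dμ| → 0; in particular
∫ f dμ_n → ∫ f dμ. -/
theorem young_measures_weak_implies_stable
    {A : Type*} [MetricSpace A] [CompactSpace A] [Nonempty A]
    [MeasurableSpace A] [BorelSpace A]
    (T : ℝ) (hT : 0 < T)
    (μ : ℕ → FiniteMeasure (ℝ × A)) (μlim : FiniteMeasure (ℝ × A))
    (hproj : ∀ n, ((μ n : Measure (ℝ × A)).map Prod.fst)
      = volume.restrict (Set.Icc 0 T))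
    (hprojlim : ((μlim : Measure (ℝ × A)).map Prod.fst) = volume.restrict (Set.Icc 0 T))
    (hconv : Tendsto μ atTop (𝓝 μlim))
    (f : ℝ × A → ℝ) (hfm : Measurable f)
    (hfb : ∃ C, ∀ t ∈ Set.Icc (0:ℝ) T, ∀ a : A, |f (t, a)| ≤ C)
    (hfc : ∀ t ∈ Set.Icc (0:ℝ) T, Continuous fun a => f (t, a)) :
    Tendsto (fun n => ⨆ t : Set.Icc (0:ℝ) T,
        |(∫ x in {p : ℝ × A | p.1 ≤ (t : ℝ)}, f x ∂(μ n : Measure (ℝ × A))) -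
          ∫ x in {p : ℝ × A | p.1 ≤ (t : ℝ)}, f x ∂(μlim : Measure (ℝ × A))|)
      atTop (𝓝 0) ∧
    Tendsto (fun n => ∫ x, f x ∂(μ n : Measure (ℝ × A))) atTop
      (𝓝 (∫ x, f x ∂(μlim : Measure (ℝ × A)))) := by
  obtain ⟨C, hC⟩ := hfb
  have hC0 : 0 ≤ C := (abs_nonneg _).trans (hC 0 ⟨le_rfl, hT.le⟩ (Classical.arbitrary A))
  have hmS : MeasurableSet (Prod.fst ⁻¹' Set.Icc (0:ℝ) T : Set (ℝ × A)) :=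
    measurable_fst measurableSet_Icc
  let f₀ : ℝ × A → ℝ := (Prod.fst ⁻¹' Set.Icc (0:ℝ) T).indicator f
  have hf₀m : Measurable f₀ := hfm.indicator hmS
  have hf₀b : ∀ x, |f₀ x| ≤ C := by
    intro x
    by_cases hx : x ∈ (Prod.fst ⁻¹' Set.Icc (0:ℝ) T : Set (ℝ × A))
    · simp only [f₀, Set.indicator_of_mem hx]; exact hC x.1 hx x.2
    · simp only [f₀, Set.indicator_of_notMem hx]; simpa using hC0
  have hf₀c : ∀ t, Continuous fun a => f₀ (t, a) := by
    intro t
    by_cases ht : t ∈ Set.Icc (0:ℝ) T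
    · have : (fun a => f₀ (t, a)) = fun a => f (t, a) := by
        funext a; exact Set.indicator_of_mem (s := Prod.fst ⁻¹' Set.Icc (0:ℝ) T) ht f
      rw [this]; exact hfc t ht
    · have : (fun a => f₀ (t, a)) = fun a => 0 := by
        funext a; exact Set.indicator_of_notMem (s := Prod.fst ⁻¹' Set.Icc (0:ℝ) T) ht f
      rw [this]; exact continuous_const
  have hae : ∀ ν : FiniteMeasure (ℝ × A),
      ((ν : Measure (ℝ × A)).map Prod.fst) = volume.restrict (Set.Icc 0 T) →
      f =ᵐ[(ν : Measure (ℝ × A))] f₀ := by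
    intro ν hν
    have h1 : ∀ᵐ t ∂((ν : Measure (ℝ × A)).map Prod.fst), t ∈ Set.Icc (0:ℝ) T := by
      rw [hν]; exact ae_restrict_mem measurableSet_Icc
    filter_upwards [ae_of_ae_map measurable_fst.aemeasurable h1] with x hx
    exact (Set.indicator_of_mem (s := Prod.fst ⁻¹' Set.Icc (0:ℝ) T) hx f).symm
  have e1 : ∀ n (S : Set (ℝ × A)), ∫ x in S, f x ∂(μ n : Measure (ℝ × A))
      = ∫ x in S, f₀ x ∂(μ n : Measure (ℝ × A)) := fun n S =>
    integral_congr_ae (ae_restrict_of_ae (hae _ (hproj n)))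
  have e2 : ∀ (S : Set (ℝ × A)), ∫ x in S, f x ∂(μlim : Measure (ℝ × A))
      = ∫ x in S, f₀ x ∂(μlim : Measure (ℝ × A)) := fun S =>
    integral_congr_ae (ae_restrict_of_ae (hae _ hprojlim))
  constructor
  · simp only [e1, e2]
    exact YoungAux.uniform T μ μlim hproj hprojlim hconv f₀ hf₀m C hC0 hf₀b hf₀c
  · rw [integral_congr_ae (hae _ hprojlim)]
    simp only [fun n => integral_congr_ae (hae _ (hproj n))]
    exact YoungAux.main T μ μlim hproj hprojlim hconv f₀ hf₀m C hf₀b hf₀c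
end

section
/- Chattering lemma (Lemma 3.8): let μ = μ(ω) be a relaxed control, i.e. a random variable with values in 𝕍 such that for each t ∈ [0,T] the restriction of μ(ω) to [0,t] × A is F_t-measurable. Then there exists a sequence of progressively measurable processes u_n : Ω × [0,T] → A such that, P-almost surely: (i) the random Young measures μ_n(ω), defined as the pushforward of Lebesgue measure on [0,T] under t ↦ (t, u_n(ω,t)), converge weakly in 𝕍 to μ(ω); and (ii) for every bounded Borel measurable function g : [0,T] × A → ℝ with a ↦ g(t,a) continuous for each t, one has ∫_{[0,t] × A} g dμ_n(ω) → ∫_{[0,t] × A} g dμ(ω) uniformly in t ∈ [0,T]. -/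
open MeasureTheory Filter Topology

namespace Chat

lemma fin_of_marg {A : Type*} [MeasurableSpace A] {T : ℝ} {m : Measure (ℝ × A)}
    (hm : m.map Prod.fst = volume.restrict (Set.Icc 0 T)) : IsFiniteMeasure m := by
  constructor
  have : m Set.univ = (m.map Prod.fst) Set.univ := by
    rw [Measure.map_apply measurable_fst MeasurableSet.univ]; simp
  rw [this, hm]
  simp

lemma bound {A : Type*} [MeasurableSpace A] {T : ℝ} {m : Measure (ℝ × A)}
    (hm : m.map Prod.fst = volume.restrict (Set.Icc 0 T)) {S : Set ℝ} (hS : MeasurableSet S)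
    {a b C : ℝ} (hab : a ≤ b) (hsub : S ∩ Set.Icc 0 T ⊆ Set.Icc a b) (hC : 0 ≤ C)
    {f : ℝ × A → ℝ} (hf : ∀ p, p.1 ∈ S → |f p| ≤ C) :
    |∫ p in Prod.fst ⁻¹' S, f p ∂m| ≤ C * (b - a) := by
  have := fin_of_marg hm
  refine (norm_setIntegral_le_of_norm_le_const (measure_lt_top _ _) (fun x hx => (Real.norm_eq_abs (f x)).le.trans (hf x hx))).trans ?_
  refine mul_le_mul_of_nonneg_left ?_ hC
  have : m (Prod.fst ⁻¹' S) ≤ ENNReal.ofReal (b - a) := by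
    rw [← Measure.map_apply measurable_fst hS, hm, Measure.restrict_apply hS, ← Real.volume_Icc]
    exact measure_mono hsub
  exact ENNReal.toReal_le_of_le_ofReal (by linarith) this

lemma single {A : Type*} [MeasurableSpace A] {T h C δ : ℝ} {m m' : Measure (ℝ × A)}
    (hm : m.map Prod.fst = volume.restrict (Set.Icc 0 T))
    (hm' : m'.map Prod.fst = volume.restrict (Set.Icc 0 T))
    (hh : 0 < h) (hC : 0 ≤ C) (hδ : 0 ≤ δ)
    {H : ℝ × A → ℝ} (hH : Measurable H) (hHC : ∀ p, |H p| ≤ C)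
    (hosc : ∀ s s' a, |s - s'| ≤ h → |H (s, a) - H (s', a)| ≤ δ)
    (hcell : ∀ k : ℕ, (k + 2) * h ≤ T → ∀ s,
      ∫ p in Prod.fst ⁻¹' Set.Ico ((k + 1) * h) ((k + 2) * h), H (s, p.2) ∂m'
        = ∫ p in Prod.fst ⁻¹' Set.Ico (k * h) ((k + 1) * h), H (s, p.2) ∂m)
    {t : ℝ} (ht : t ∈ Set.Icc 0 T) :
    |(∫ p in {p : ℝ × A | p.1 ≤ t}, H p ∂m') - ∫ p in {p : ℝ × A | p.1 ≤ t}, H p ∂m|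
      ≤ 4 * C * h + 2 * δ * T := by
  have := fin_of_marg hm
  have := fin_of_marg hm'
  have hInta : ∀ (ν : Measure (ℝ × A)) [IsFiniteMeasure ν], Integrable H ν := fun ν _ =>
    Integrable.of_bound hH.aestronglyMeasurable C (Eventually.of_forall hHC)
  have hIntb : ∀ (ν : Measure (ℝ × A)) [IsFiniteMeasure ν] (s : ℝ),
      Integrable (fun p : ℝ × A => H (s, p.2)) ν := fun ν _ s =>
    Integrable.of_bound (hH.comp (by fun_prop)).aestronglyMeasurable C
      (Eventually.of_forall fun p => hHC _)
  have hcell2 : ∀ k : ℕ, (k + 2) * h ≤ T →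
      |(∫ p in Prod.fst ⁻¹' Set.Ico ((k + 1) * h) ((k + 2) * h), H p ∂m')
        - ∫ p in Prod.fst ⁻¹' Set.Ico (k * h) ((k + 1) * h), H p ∂m| ≤ 2 * δ * h := by
    intro k hk
    have e := hcell k hk ((k + 1) * h)
    have e1 : |∫ p in Prod.fst ⁻¹' Set.Ico ((k + 1) * h) ((k + 2) * h),
        (H p - H ((k + 1) * h, p.2)) ∂m'| ≤ δ * ((k + 2) * h - (k + 1) * h) := by
      refine bound hm' measurableSet_Ico (by nlinarith)
        (fun x hx => Set.Ico_subset_Icc_self hx.1) hδ ?_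
      rintro ⟨s, a⟩ hs
      refine hosc _ _ _ ?_
      simp only [Set.mem_Ico] at hs
      rw [abs_le]; constructor <;> nlinarith
    have e2 : |∫ p in Prod.fst ⁻¹' Set.Ico (k * h) ((k + 1) * h),
        (H p - H ((k + 1) * h, p.2)) ∂m| ≤ δ * ((k + 1) * h - k * h) := by
      refine bound hm measurableSet_Ico (by nlinarith)
        (fun x hx => Set.Ico_subset_Icc_self hx.1) hδ ?_
      rintro ⟨s, a⟩ hs
      refine hosc _ _ _ ?_
      simp only [Set.mem_Ico] at hs
      rw [abs_le]; constructor <;> nlinarith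
    rw [integral_sub (hInta _) (hIntb _ _)] at e1 e2
    rw [abs_le] at *
    constructor <;> nlinarith
  have hadd : ∀ (ν : Measure (ℝ × A)) [IsFiniteMeasure ν] (a b : ℝ), a ≤ b →
      ∫ p in Prod.fst ⁻¹' Set.Iio b, H p ∂ν = (∫ p in Prod.fst ⁻¹' Set.Iio a, H p ∂ν)
        + ∫ p in Prod.fst ⁻¹' Set.Ico a b, H p ∂ν := by
    intro ν _ a b hab
    rw [← setIntegral_union _ (measurable_fst measurableSet_Ico) (hInta _) (hInta _),
      ← Set.preimage_union, Set.Iio_union_Ico_eq_Iio hab]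
    refine Disjoint.preimage _ ?_
    rw [Set.disjoint_left]
    intro x hx hx'
    exact absurd hx (not_lt.2 hx'.1)
  have hadd2 : ∀ (ν : Measure (ℝ × A)) [IsFiniteMeasure ν] (a b : ℝ), a ≤ b →
      ∫ p in {p : ℝ × A | p.1 ≤ b}, H p ∂ν = (∫ p in Prod.fst ⁻¹' Set.Iio a, H p ∂ν)
        + ∫ p in Prod.fst ⁻¹' Set.Icc a b, H p ∂ν := by
    intro ν _ a b hab
    rw [← setIntegral_union _ (measurable_fst measurableSet_Icc) (hInta _) (hInta _),
      ← Set.preimage_union, Set.Iio_union_Icc_eq_Iic hab]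
    · rfl
    refine Disjoint.preimage _ ?_
    rw [Set.disjoint_left]
    intro x hx hx'
    exact absurd hx (not_lt.2 hx'.1)
  have hind : ∀ K : ℕ, (K + 1) * h ≤ T →
      |(∫ p in Prod.fst ⁻¹' Set.Iio ((K + 1) * h), H p ∂m')
        - ∫ p in Prod.fst ⁻¹' Set.Iio (K * h), H p ∂m| ≤ C * h + 2 * δ * h * K := by
    intro K
    induction K with
    | zero =>
      intro hK
      have e1 : |∫ p in Prod.fst ⁻¹' Set.Iio h, H p ∂m'| ≤ C * (h - 0) :=
        bound hm' measurableSet_Iio hh.le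
          (fun x hx => ⟨hx.2.1, le_of_lt hx.1⟩) hC (fun p _ => hHC p)
      have e2 : |∫ p in Prod.fst ⁻¹' Set.Iio 0, H p ∂m| ≤ C * (0 - 0) :=
        bound hm measurableSet_Iio le_rfl
          (fun x hx => ⟨hx.2.1, le_of_lt hx.1⟩) hC (fun p _ => hHC p)
      simp only [Nat.cast_zero, zero_add, one_mul, zero_mul]
      rw [abs_le] at *
      constructor <;> linarith
    | succ K ih =>
      intro hK
      push_cast at hK ⊢
      have hK2 : ((K : ℝ) + 2) * h ≤ T := by linarith
      have h1 := ih (by nlinarith)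
      have h2 := hcell2 K hK2
      have e1 := hadd m' ((K + 1) * h) ((K + 2) * h) (by nlinarith)
      have e2 := hadd m (K * h) ((K + 1) * h) (by nlinarith)
      rw [show (K : ℝ) + 1 + 1 = K + 2 by ring, e1, e2]
      rw [abs_le] at *
      constructor <;> linarith
  obtain ⟨ht0, htT⟩ := ht
  have hf1 := Nat.floor_le (div_nonneg ht0 hh.le)
  have hf2 := Nat.lt_floor_add_one (t / h)
  rw [le_div_iff₀ hh] at hf1
  rw [div_lt_iff₀ hh] at hf2
  have hCh : 0 ≤ C * h := by positivity
  have hδT : 0 ≤ δ * T := mul_nonneg hδ (ht0.trans htT)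
  rcases Nat.eq_zero_or_eq_succ_pred ⌊t / h⌋₊ with h0 | h0
  · rw [h0] at hf2
    have e : ∀ ν : Measure (ℝ × A), ν.map Prod.fst = volume.restrict (Set.Icc 0 T) →
        |∫ p in {p : ℝ × A | p.1 ≤ t}, H p ∂ν| ≤ C * (t - 0) := fun ν hν =>
      bound hν measurableSet_Iic ht0
          (fun x hx => ⟨hx.2.1, hx.1⟩) hC (fun p _ => hHC p)
    have e1 := e m hm
    have e2 := e m' hm'
    have : C * t ≤ C * h := mul_le_mul_of_nonneg_left (by simpa using hf2.le) hC
    rw [abs_le] at *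
    constructor <;> linarith
  · generalize (⌊t / h⌋₊).pred = K at h0
    rw [h0] at hf1 hf2
    push_cast at hf1 hf2
    have e1 := hadd2 m' ((K + 1) * h) t hf1
    have e2 := hadd2 m (K * h) t (by nlinarith)
    have e3 := hind K (hf1.trans htT)
    have e4 : |∫ p in Prod.fst ⁻¹' Set.Icc ((K + 1) * h) t, H p ∂m'| ≤ C * (t - (K + 1) * h) :=
        bound hm' measurableSet_Icc hf1
          (fun x hx => hx.1) hC (fun p _ => hHC p)
    have e5 : |∫ p in Prod.fst ⁻¹' Set.Icc (K * h) t, H p ∂m| ≤ C * (t - K * h) :=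
        bound hm measurableSet_Icc (by nlinarith)
          (fun x hx => hx.1) hC (fun p _ => hHC p)
    have e6 : C * (t - (K + 1) * h) ≤ C * h := mul_le_mul_of_nonneg_left (by linarith) hC
    have e7 : C * (t - K * h) ≤ C * (2 * h) := mul_le_mul_of_nonneg_left (by linarith) hC
    have e8 : δ * (K * h) ≤ δ * T := mul_le_mul_of_nonneg_left (by nlinarith) hδ
    rw [e1, e2]
    rw [abs_le] at *
    constructor <;> linarith

lemma curry_meas {A : Type*} [MetricSpace A] [CompactSpace A] [Nonempty A]
    [MeasurableSpace A] [BorelSpace A] [MeasurableSpace C(A, ℝ)] [BorelSpace C(A, ℝ)]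
    (G : ℝ → C(A, ℝ)) (hG : ∀ a, Measurable fun t => G t a) : Measurable G := by
  let Φ : C(A, ℝ) → (ℕ → ℝ) := fun f n => f (TopologicalSpace.denseSeq A n)
  have hΦc : Continuous Φ := continuous_pi fun n => by fun_prop
  have hΦi : Function.Injective Φ := by
    intro f g hfg
    refine DFunLike.coe_injective ?_
    refine Continuous.ext_on (TopologicalSpace.denseRange_denseSeq A) f.continuous g.continuous ?_
    rintro _ ⟨n, rfl⟩
    exact congrFun hfg n
  have hP : PolishSpace C(A, ℝ) := inferInstance
  rw [← (hΦc.measurableEmbedding hΦi).measurable_comp_iff]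
  exact measurable_pi_lambda _ fun n => hG _

lemma approx {A : Type*} [MetricSpace A] [CompactSpace A] [Nonempty A]
    [MeasurableSpace A] [BorelSpace A] {T : ℝ}
    {g : ℝ × A → ℝ} (hg : Measurable g) {C : ℝ} (hgC : ∀ x, |g x| ≤ C)
    (hgc : ∀ t ∈ Set.Icc (0:ℝ) T, Continuous fun a => g (t, a)) {ε : ℝ} (hε : 0 < ε) :
    ∃ H : ℝ → C(A, ℝ), UniformContinuous H ∧ HasCompactSupport H ∧
      ∀ m : Measure (ℝ × A), m.map Prod.fst = volume.restrict (Set.Icc 0 T) →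
        ∀ t : ℝ, |(∫ p in {p : ℝ × A | p.1 ≤ t}, g p ∂m)
          - ∫ p in {p : ℝ × A | p.1 ≤ t}, H p.1 p.2 ∂m| ≤ ε := by
  classical
  let : MeasurableSpace C(A, ℝ) := borel _
  have : BorelSpace C(A, ℝ) := ⟨rfl⟩
  let G : ℝ → C(A, ℝ) := fun t => if h : t ∈ Set.Icc (0:ℝ) T then ⟨_, hgc t h⟩ else 0
  have hGe : ∀ t ∈ Set.Icc (0:ℝ) T, ∀ a, G t a = g (t, a) := by
    intro t ht a
    simp only [G, dif_pos ht]; rfl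
  have hGm : Measurable G := by
    refine curry_meas _ fun a => ?_
    have : (fun t => G t a) = (Set.Icc (0:ℝ) T).indicator (fun t => g (t, a)) := by
      ext t
      by_cases ht : t ∈ Set.Icc (0:ℝ) T
      · rw [Set.indicator_of_mem ht, hGe t ht]
      · rw [Set.indicator_of_notMem ht]; simp only [G, dif_neg ht]; rfl
    rw [this]
    exact (hg.comp (by fun_prop)).indicator measurableSet_Icc
  have hC : 0 ≤ C := (abs_nonneg _).trans (hgC (0, Classical.arbitrary A))
  have hGb : ∀ t, ‖G t‖ ≤ C := by
    intro t
    rw [ContinuousMap.norm_le _ hC]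
    intro a
    by_cases ht : t ∈ Set.Icc (0:ℝ) T
    · rw [hGe t ht]; exact hgC _
    · simp only [G, dif_neg ht]; simpa using hC
  have hGi : Integrable G (volume.restrict (Set.Icc 0 T)) :=
    Integrable.of_bound hGm.aestronglyMeasurable C (Eventually.of_forall hGb)
  obtain ⟨H, hHs, hHe, hHc, hHi⟩ := hGi.exists_hasCompactSupport_integral_sub_le hε
  refine ⟨H, hHs.uniformContinuous_of_continuous hHc, hHs, ?_⟩
  intro m hm t
  have := fin_of_marg hm
  obtain ⟨D, hD⟩ := hHs.exists_bound_of_continuous hHc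
  have hHj : Measurable fun p : ℝ × A => H p.1 p.2 := by
    have : Continuous fun p : ℝ × A => H p.1 p.2 := by fun_prop
    exact this.measurable
  have hi1 : Integrable g m :=
    Integrable.of_bound hg.aestronglyMeasurable C (Eventually.of_forall hgC)
  have hi2 : Integrable (fun p : ℝ × A => H p.1 p.2) m :=
    Integrable.of_bound hHj.aestronglyMeasurable D
      (Eventually.of_forall fun p => ((H p.1).norm_coe_le_norm _).trans (hD _))
  have hsub : AEStronglyMeasurable (fun s => ‖G s - H s‖) (m.map Prod.fst) := by
    exact ((hGm.sub hHc.measurable).norm).aestronglyMeasurable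
  have hi3 : Integrable (fun p : ℝ × A => ‖G p.1 - H p.1‖) m := by
    have : Integrable (fun s => ‖G s - H s‖) (m.map Prod.fst) := by
      rw [hm]; exact (hGi.sub hHi).norm
    exact (integrable_map_measure hsub measurable_fst.aemeasurable).1 this
  rw [← integral_sub hi1.integrableOn hi2.integrableOn]
  have hae : ∀ᵐ p ∂m, p.1 ∈ Set.Icc (0:ℝ) T := by
    have : ∀ᵐ s ∂(m.map Prod.fst), s ∈ Set.Icc (0:ℝ) T := by
      rw [hm]; exact ae_restrict_mem measurableSet_Icc
    exact ae_of_ae_map measurable_fst.aemeasurable this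
  calc _ ≤ ∫ p in {p : ℝ × A | p.1 ≤ t}, |g p - H p.1 p.2| ∂m := abs_integral_le_integral_abs
    _ ≤ ∫ p, |g p - H p.1 p.2| ∂m :=
        setIntegral_le_integral (hi1.sub hi2).abs (Eventually.of_forall fun _ => abs_nonneg _)
    _ ≤ ∫ p, ‖G p.1 - H p.1‖ ∂m := by
        refine integral_mono_ae (hi1.sub hi2).abs hi3 ?_
        filter_upwards [hae] with p hp
        have := (G p.1 - H p.1).norm_coe_le_norm p.2
        rwa [ContinuousMap.sub_apply, hGe _ hp] at this
    _ = ∫ s, ‖G s - H s‖ ∂(m.map Prod.fst) := (integral_map measurable_fst.aemeasurable hsub).symm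
    _ ≤ ε := by rw [hm]; exact hHe

lemma det {A : Type*} [MetricSpace A] [CompactSpace A] [Nonempty A]
    [MeasurableSpace A] [BorelSpace A] {T : ℝ} (hT : 0 < T) {m : Measure (ℝ × A)}
    {m' : ℕ → Measure (ℝ × A)}
    (hm : m.map Prod.fst = volume.restrict (Set.Icc 0 T))
    (hm' : ∀ n, (m' n).map Prod.fst = volume.restrict (Set.Icc 0 T))
    {h : ℕ → ℝ} (hh : ∀ n, 0 < h n) (hlim : Tendsto h atTop (𝓝 0))
    (hcell : ∀ n, ∀ k : ℕ, (k + 2) * h n ≤ T → ∀ ψ : C(A, ℝ),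
      ∫ p in Prod.fst ⁻¹' Set.Ico ((k + 1) * h n) ((k + 2) * h n), ψ p.2 ∂(m' n)
        = ∫ p in Prod.fst ⁻¹' Set.Ico (k * h n) ((k + 1) * h n), ψ p.2 ∂m)
    {g : ℝ × A → ℝ} (hg : Measurable g) {C : ℝ} (hgC : ∀ x, |g x| ≤ C)
    (hgc : ∀ t ∈ Set.Icc (0:ℝ) T, Continuous fun a => g (t, a)) :
    TendstoUniformlyOn (fun n t => ∫ x in {p : ℝ × A | p.1 ≤ t}, g x ∂(m' n))
      (fun t => ∫ x in {p : ℝ × A | p.1 ≤ t}, g x ∂m) atTop (Set.Icc (0:ℝ) T) := by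
  rw [Metric.tendstoUniformlyOn_iff]
  intro ε hε
  obtain ⟨H, hHu, hHs, hHa⟩ := approx (T := T) hg hgC hgc (ε := ε / 8) (by positivity)
  obtain ⟨D, hD⟩ := hHs.exists_bound_of_continuous hHu.continuous
  have hD0 : 0 ≤ D := (norm_nonneg _).trans (hD 0)
  obtain ⟨η, hη, hHη⟩ := Metric.uniformContinuous_iff.1 hHu (ε / (8 * T)) (by positivity)
  have hHj : Measurable fun p : ℝ × A => H p.1 p.2 := by
    have := hHu.continuous
    have : Continuous fun p : ℝ × A => H p.1 p.2 := by fun_prop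
    exact this.measurable
  have hl2 : ∀ᶠ n in atTop, h n < η := hlim.eventually (gt_mem_nhds hη)
  have hl3 : ∀ᶠ n in atTop, 4 * D * h n < ε / 8 := by
    have : Tendsto (fun n => 4 * D * h n) atTop (𝓝 (4 * D * 0)) := hlim.const_mul _
    rw [mul_zero] at this
    exact this.eventually (gt_mem_nhds (by positivity))
  filter_upwards [hl2, hl3] with n hn2 hn3 t ht
  have e := single (δ := ε / (8 * T)) hm (hm' n) (hh n) hD0 (by positivity) hHj
    (fun p => ((H p.1).norm_coe_le_norm _).trans (hD _))
    (fun s s' a hs => by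
      have := (hHη (a := s) (b := s') (lt_of_le_of_lt hs hn2)).le
      rw [dist_eq_norm] at this
      exact ((H s - H s').norm_coe_le_norm a).trans this)
    (fun k hk s => hcell n k hk (H s)) ht
  have e1 := hHa m hm t
  have e2 := hHa (m' n) (hm' n) t
  have e3 : 2 * (ε / (8 * T)) * T = ε / 4 := by field_simp; norm_num
  rw [Real.dist_eq]
  rw [e3] at e
  rw [abs_le] at e e1 e2
  rw [abs_lt]
  constructor <;> linarith



lemma exists_kernel (A : Type*) [MetricSpace A] [CompactSpace A] [Nonempty A]
    [MeasurableSpace A] [BorelSpace A] :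
    ∃ f : Measure A → unitInterval → A, Measurable (Function.uncurry f) ∧
      ∀ m : Measure A, m Set.univ = 1 → volume.map (f m) = m := by
  classical
  let κ : ProbabilityTheory.Kernel (Measure A) A :=
    { toFun := fun m => if m Set.univ = 1 then m else Measure.dirac (Classical.arbitrary A)
      measurable' := by
        refine Measurable.ite ?_ measurable_id measurable_const
        exact (Measure.measurable_coe MeasurableSet.univ) (measurableSet_singleton 1) }
  have hκ : ∀ m, κ m = if m Set.univ = 1 then m else Measure.dirac (Classical.arbitrary A) :=
    fun m => rfl
  have : ProbabilityTheory.IsMarkovKernel κ := by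
    constructor
    intro m
    rw [hκ]
    split_ifs with h
    · exact ⟨h⟩
    · infer_instance
  obtain ⟨f, hf, hf2⟩ := κ.exists_measurable_map_eq_unitInterval
  refine ⟨f, hf, fun m hm => ?_⟩
  rw [hf2, hκ, if_pos hm]

/-- normalized occupation measure of the `k-1`-st cell -/
noncomputable def nu {A : Type*} [MeasurableSpace A] (h : ℝ) (k : ℤ) (m : Measure (ℝ × A)) :
    Measure A :=
  (ENNReal.ofReal h)⁻¹ • (m.restrict (Prod.fst ⁻¹' Set.Ico ((k - 1) * h) (k * h))).map Prod.snd

lemma nu_meas {A : Type*} [MeasurableSpace A] (h : ℝ) (k : ℤ) {Ω : Type*} [mΩ : MeasurableSpace Ω]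
    (μ : Ω → Measure (ℝ × A)) {t : ℝ} (hk : k * h ≤ t)
    (hμ : Measurable fun ω => (μ ω).restrict {p : ℝ × A | p.1 ≤ t}) :
    Measurable fun ω => nu h k (μ ω) := by
  refine Measure.measurable_of_measurable_coe _ fun B hB => ?_
  have hS : MeasurableSet (Prod.fst ⁻¹' Set.Ico ((k - 1) * h) (k * h) : Set (ℝ × A)) :=
    measurable_fst measurableSet_Ico
  have hB' : MeasurableSet (Prod.snd ⁻¹' B : Set (ℝ × A)) := measurable_snd hB
  have : (fun ω => nu h k (μ ω) B) = fun ω => (ENNReal.ofReal h)⁻¹ *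
      ((μ ω).restrict {p : ℝ × A | p.1 ≤ t})
        (Prod.snd ⁻¹' B ∩ Prod.fst ⁻¹' Set.Ico ((k - 1) * h) (k * h)) := by
    ext ω
    rw [nu, Measure.smul_apply, Measure.map_apply measurable_snd hB, Measure.restrict_apply hB',
      Measure.restrict_apply (hB'.inter hS), smul_eq_mul]
    congr 2
    refine (Set.inter_eq_left.2 ?_).symm
    rintro p ⟨-, hp⟩
    exact hp.2.le.trans hk
  rw [this]
  exact ((Measure.measurable_coe (hB'.inter hS)).comp hμ).const_mul _

lemma nu_univ {A : Type*} [MeasurableSpace A] {T h : ℝ} (hh : 0 < h) (k : ℕ) {m : Measure (ℝ × A)}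
    (hm : m.map Prod.fst = volume.restrict (Set.Icc 0 T)) (hk : (k + 1) * h ≤ T) :
    nu h (k + 1) m Set.univ = 1 := by
  rw [nu, Measure.smul_apply, Measure.map_apply measurable_snd MeasurableSet.univ]
  simp only [Set.preimage_univ, Measure.restrict_apply MeasurableSet.univ, Set.univ_inter]
  rw [← Measure.map_apply measurable_fst measurableSet_Ico, hm,
    Measure.restrict_apply measurableSet_Ico, Set.inter_eq_left.2, Real.volume_Ico, smul_eq_mul]
  · push_cast
    rw [show ((k:ℝ) + 1) * h - (k + 1 - 1) * h = h by ring]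
    exact ENNReal.inv_mul_cancel (by simpa using hh) ENNReal.ofReal_ne_top
  · intro x hx
    push_cast at hx
    simp only [Set.mem_Ico] at hx
    have : 0 ≤ (k:ℝ) * h := by positivity
    exact ⟨by nlinarith, by nlinarith⟩

lemma nu_integral {A : Type*} [MetricSpace A] [CompactSpace A] [Nonempty A]
    [MeasurableSpace A] [BorelSpace A] {h : ℝ} (hh : 0 < h) (k : ℕ) {m : Measure (ℝ × A)}
    (ψ : C(A, ℝ)) :
    h * ∫ a, ψ a ∂(nu h (k + 1) m) =
      ∫ p in Prod.fst ⁻¹' Set.Ico (k * h) ((k + 1) * h), ψ p.2 ∂m := by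
  rw [nu, integral_smul_measure, integral_map measurable_snd.aemeasurable
    ψ.measurable.aestronglyMeasurable, ENNReal.toReal_inv, ENNReal.toReal_ofReal hh.le,
    smul_eq_mul, mul_inv_cancel_left₀ hh.ne']
  push_cast
  rw [show ((k:ℝ) + 1 - 1) = k by ring]

/-- the control -/
noncomputable def ctl {A : Type*} [MeasurableSpace A] (f : Measure A → unitInterval → A) (h : ℝ)
    (m : Measure (ℝ × A)) (t : ℝ) : A :=
  f (nu h ⌊t / h⌋ m) (Set.projIcc 0 1 zero_le_one (Int.fract (t / h)))

lemma ctl_prog {A : Type*} [MetricSpace A] [CompactSpace A] [Nonempty A]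
    [MeasurableSpace A] [BorelSpace A] {f : Measure A → unitInterval → A}
    (hf : Measurable (Function.uncurry f)) {h : ℝ} (hh : 0 < h)
    {Ω : Type*} [MeasurableSpace Ω] (μ : Ω → Measure (ℝ × A)) (i : ℝ)
    (hadapted : Measurable fun ω => (μ ω).restrict {p : ℝ × A | p.1 ≤ i}) :
    Measurable fun p : Set.Iic i × Ω => ctl f h (μ p.2) p.1 := by
  have h1 : Measurable fun q : ℤ × Ω => nu h (min q.1 ⌊i / h⌋) (μ q.2) := by
    apply measurable_from_prod_countable_right
    intro k
    refine nu_meas h (min k ⌊i / h⌋) μ (t := i) ?_ hadapted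
    have : ((min k ⌊i / h⌋ : ℤ) : ℝ) ≤ i / h :=
      (Int.cast_le.2 (min_le_right _ _)).trans (Int.floor_le _)
    rwa [le_div_iff₀ hh] at this
  have h2 : Measurable fun p : Set.Iic i × Ω => (p.1 : ℝ) / h := by fun_prop
  have h3 : Measurable fun p : Set.Iic i × Ω =>
      (nu h (min ⌊(p.1 : ℝ) / h⌋ ⌊i / h⌋) (μ p.2),
        Set.projIcc (0:ℝ) 1 zero_le_one (Int.fract ((p.1 : ℝ) / h))) :=
    (h1.comp (h2.floor.prodMk measurable_snd)).prodMk
      ((continuous_projIcc (h := zero_le_one)).measurable.comp h2.fract)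
  have h4 := hf.comp h3
  convert h4 using 1
  ext p
  simp only [ctl, Function.comp, Function.uncurry]
  rw [min_eq_left]
  refine Int.floor_le_floor ?_
  have := p.1.2
  simp only [Set.mem_Iic] at this
  gcongr

lemma ctl_meas {A : Type*} [MetricSpace A] [CompactSpace A] [Nonempty A]
    [MeasurableSpace A] [BorelSpace A] {f : Measure A → unitInterval → A}
    (hf : Measurable (Function.uncurry f)) (h : ℝ) (m : Measure (ℝ × A)) :
    Measurable (ctl f h m) := by
  have h2 : Measurable fun t : ℝ => t / h := by fun_prop
  have h1 : Measurable fun k : ℤ => nu h k m := measurable_of_countable _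
  exact hf.comp ((h1.comp h2.floor).prodMk ((continuous_projIcc (h := zero_le_one)).measurable.comp h2.fract))

lemma ctl_cell {A : Type*} [MetricSpace A] [CompactSpace A] [Nonempty A]
    [MeasurableSpace A] [BorelSpace A] {f : Measure A → unitInterval → A}
    (hf : Measurable (Function.uncurry f))
    (hf2 : ∀ m : Measure A, m Set.univ = 1 → volume.map (f m) = m)
    {T h : ℝ} (hh : 0 < h) {m : Measure (ℝ × A)}
    (hm : m.map Prod.fst = volume.restrict (Set.Icc 0 T))
    (k : ℕ) (hk : (k + 2) * h ≤ T) (ψ : C(A, ℝ)) :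
    ∫ p in Prod.fst ⁻¹' Set.Ico ((k + 1) * h) ((k + 2) * h), ψ p.2
        ∂((volume.restrict (Set.Icc (0:ℝ) T)).map (fun s => (s, ctl f h m s)))
      = ∫ p in Prod.fst ⁻¹' Set.Ico (k * h) ((k + 1) * h), ψ p.2 ∂m := by
  have hc := ctl_meas hf h m
  have hfm : Measurable (f (nu h (k + 1) m)) := hf.of_uncurry_left
  have hkh : 0 ≤ (k : ℝ) * h := by positivity
  rw [setIntegral_map (measurable_fst measurableSet_Ico)
    (Measurable.aestronglyMeasurable (by fun_prop)) (by fun_prop)]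
  have hpre : (fun s => (s, ctl f h m s)) ⁻¹'
      (Prod.fst ⁻¹' Set.Ico ((k + 1) * h) ((k + 2) * h)) =
      Set.Ico ((k + 1) * h) ((k + 2) * h) := rfl
  rw [hpre, Measure.restrict_restrict measurableSet_Ico, Set.inter_eq_left.2]
  swap
  · intro x hx
    simp only [Set.mem_Ico] at hx
    exact ⟨by nlinarith, by nlinarith⟩
  let φ : ℝ → ℝ := fun x => ψ (f (nu h (k + 1) m) (Set.projIcc 0 1 zero_le_one x))
  have e1 : ∫ s in Set.Ico ((k + 1) * h) ((k + 2) * h), ψ (ctl f h m s) =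
      ∫ s in Set.Ico ((k + 1) * h) ((k + 2) * h), φ (s / h - (k + 1)) := by
    refine setIntegral_congr_fun measurableSet_Ico fun s hs => ?_
    simp only [Set.mem_Ico] at hs
    have hfl : ⌊s / h⌋ = (k : ℤ) + 1 := by
      rw [Int.floor_eq_iff, le_div_iff₀ hh, div_lt_iff₀ hh]
      push_cast
      constructor <;> linarith
    have hfr : Int.fract (s / h) = s / h - (k + 1) := by
      rw [Int.fract, hfl]; push_cast; rfl
    simp only [φ, ctl, hfl, hfr]
  change ∫ s in Set.Ico ((k + 1) * h) ((k + 2) * h), ψ (ctl f h m s) = _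
  rw [e1, integral_Ico_eq_integral_Ioc, ← intervalIntegral.integral_of_le (by nlinarith),
    intervalIntegral.integral_comp_div_sub φ hh.ne', mul_div_cancel_right₀ _ hh.ne',
    mul_div_cancel_right₀ _ hh.ne', sub_self, show (k:ℝ) + 2 - (k + 1) = 1 by ring,
    intervalIntegral.integral_of_le zero_le_one, ← integral_Icc_eq_integral_Ioc,
    ← integral_subtype_comap measurableSet_Icc, ← nu_integral hh k ψ, smul_eq_mul]
  congr 1
  have hu := hf2 _ (nu_univ hh k hm (by nlinarith))
  conv_rhs => rw [← hu]
  rw [integral_map hfm.aemeasurable ψ.measurable.aestronglyMeasurable, unitInterval.volume_def]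
  refine integral_congr_ae (Eventually.of_forall fun x => ?_)
  simp only [φ, Set.projIcc_val]

end Chat

/-- Chattering lemma, Lemma 3.8: if μ is a relaxed control, i.e. a random
Young measure on [0,T] × A which is adapted in the sense that for each t the restriction
of μ(ω) to [0,t] × A is F_t-measurable, then there is a sequence of progressively
measurable A-valued processes u_n such that P-a.s.: (i) the random Young measures
dt δ_{u_n(ω,t)}(da) converge weakly to μ(ω), and (ii) for every bounded Borel function
g(t,a) continuous in a, ∫_{[0,t]×A} g dμ_n(ω) → ∫_{[0,t]×A} g dμ(ω) uniformly in
t ∈ [0,T]. -/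
theorem chattering_lemma
    {A : Type*} [MetricSpace A] [CompactSpace A] [Nonempty A]
    [MeasurableSpace A] [BorelSpace A]
    {Ω : Type*} [mΩ : MeasurableSpace Ω]
    (T : ℝ) (hT : 0 < T)
    (P : Measure Ω) [IsProbabilityMeasure P]
    (F : Filtration ℝ mΩ)
    (μ : Ω → Measure (ℝ × A))
    (hV : ∀ ω, (μ ω).map Prod.fst = volume.restrict (Set.Icc 0 T))
    (hadapted : ∀ t : ℝ,
      Measurable[F t] fun ω => (μ ω).restrict {p : ℝ × A | p.1 ≤ t}) :
    ∃ u : ℕ → ℝ → Ω → A, (∀ n, ProgMeasurable F (u n)) ∧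
      ∀ᵐ ω ∂P,
        (∀ f : BoundedContinuousFunction (ℝ × A) ℝ,
          Tendsto
            (fun n => ∫ x, f x
              ∂((volume.restrict (Set.Icc (0:ℝ) T)).map (fun t => (t, u n t ω))))
            atTop (𝓝 (∫ x, f x ∂(μ ω)))) ∧
        (∀ g : ℝ × A → ℝ, Measurable g → (∃ C, ∀ x, |g x| ≤ C) →
          (∀ t ∈ Set.Icc (0:ℝ) T, Continuous fun a => g (t, a)) →
          TendstoUniformlyOn
            (fun n t => ∫ x in {p : ℝ × A | p.1 ≤ t}, g x
              ∂((volume.restrict (Set.Icc (0:ℝ) T)).map (fun s => (s, u n s ω))))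
            (fun t => ∫ x in {p : ℝ × A | p.1 ≤ t}, g x ∂(μ ω))
            atTop (Set.Icc (0:ℝ) T)) := by
  obtain ⟨f, hf, hf2⟩ := Chat.exists_kernel A
  let h : ℕ → ℝ := fun n => T / ((n : ℝ) + 1)
  have hh : ∀ n, 0 < h n := fun n => by positivity
  have hlim : Tendsto h atTop (𝓝 0) := by
    have := tendsto_one_div_add_atTop_nhds_zero_nat (𝕜 := ℝ)
    have := this.const_mul T
    simpa [h, div_eq_mul_inv] using this
  refine ⟨fun n t ω => Chat.ctl f (h n) (μ ω) t, fun n i => ?_, Eventually.of_forall fun ω => ?_⟩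
  · exact (@Chat.ctl_prog A _ _ _ _ _ f hf (h n) (hh n) Ω (F i) μ i (hadapted i)).stronglyMeasurable
  have hc : ∀ n, Measurable (Chat.ctl f (h n) (μ ω)) := fun n => Chat.ctl_meas hf _ _
  have hm' : ∀ n, ((volume.restrict (Set.Icc (0:ℝ) T)).map
      (fun t => (t, Chat.ctl f (h n) (μ ω) t))).map Prod.fst = volume.restrict (Set.Icc 0 T) := by
    intro n
    rw [Measure.map_map measurable_fst (measurable_id'.prodMk (hc n))]
    exact Measure.map_id
  have key : ∀ g : ℝ × A → ℝ, Measurable g → (∃ C, ∀ x, |g x| ≤ C) →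
          (∀ t ∈ Set.Icc (0:ℝ) T, Continuous fun a => g (t, a)) →
          TendstoUniformlyOn
            (fun n t => ∫ x in {p : ℝ × A | p.1 ≤ t}, g x
              ∂((volume.restrict (Set.Icc (0:ℝ) T)).map (fun s => (s, Chat.ctl f (h n) (μ ω) s))))
            (fun t => ∫ x in {p : ℝ × A | p.1 ≤ t}, g x ∂(μ ω))
            atTop (Set.Icc (0:ℝ) T) := by
    rintro g hg ⟨C, hC⟩ hgc
    exact Chat.det hT (hV ω) hm' hh hlim
      (fun n k hk ψ => Chat.ctl_cell hf hf2 (hh n) (hV ω) k hk ψ) hg hC hgc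
  refine ⟨fun g => ?_, key⟩
  have hall : ∀ m : Measure (ℝ × A), m.map Prod.fst = volume.restrict (Set.Icc 0 T) →
      m.restrict {p : ℝ × A | p.1 ≤ T} = m := by
    intro m hm
    refine Measure.restrict_eq_self_of_ae_mem ?_
    have : ∀ᵐ s ∂(m.map Prod.fst), s ∈ Set.Icc (0:ℝ) T := by
      rw [hm]; exact ae_restrict_mem measurableSet_Icc
    filter_upwards [ae_of_ae_map measurable_fst.aemeasurable this] with p hp
    exact hp.2
  have e := (key g g.continuous.measurable ⟨‖g‖, fun x => g.norm_coe_le_norm x⟩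
    (fun t _ => by fun_prop)).tendsto_at (Set.right_mem_Icc.2 hT.le)
  simp only [hall _ (hV ω)] at e
  refine e.congr fun n => ?_
  rw [hall _ (hm' n)]
end

section
/- Abstract form of Corollary 4.9 (pointwise maximization from spike variations): let g : [0,T] × Ω × A → ℝ be bounded and jointly measurable, such that a ↦ g(t,ω,a) is continuous for every (t,ω) and such that for every t ∈ [0,T] and a ∈ A the map ω ↦ g(t,ω,a) is F_t-measurable. Let (μ_{t,ω}) be a Markov kernel from [0,T] × Ω to A such that for each t the map ω ↦ ∫_A g(t,ω,a) μ_{t,ω}(da) is F_t-measurable. Assume that for every θ ∈ (0,T), every h > 0 with θ + h ≤ T, every B ∈ F_θ and every Borel probability measure ν on A, E[ 1_B ∫_θ^{θ+h} ( ∫_A g(t,·,a) μ_{t,·}(da) − ∫_A g(t,·,a) ν(da) ) dt ] ≥ 0. Then for Lebesgue-almost every t ∈ [0,T], P-almost surely, ∫_A g(t,ω,a) μ_{t,ω}(da) = sup_{a ∈ A} g(t,ω,a); equivalently, ∫_A g(t,ω,a) μ_{t,ω}(da) ≥ ∫_A g(t,ω,a) ν(da) for every Borel probability measure ν on A. -/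
open MeasureTheory ProbabilityTheory Filter Topology

/-- the curve `t ↦ f t` is represented by a strongly measurable curve in `L¹(P)`. -/
def HasL1Curve {Ω : Type*} [MeasurableSpace Ω] (P : Measure Ω) (f : ℝ → Ω → ℝ) : Prop :=
  ∃ G : ℝ → Lp ℝ 1 P, StronglyMeasurable G ∧ ∀ t, G t =ᵐ[P] f t

theorem HasL1Curve.add {Ω : Type*} [MeasurableSpace Ω] {P : Measure Ω} {f g : ℝ → Ω → ℝ}
    (hf : HasL1Curve P f) (hg : HasL1Curve P g) : HasL1Curve P (fun t ω => f t ω + g t ω) := by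
  obtain ⟨F, hF, hF'⟩ := hf
  obtain ⟨G, hG, hG'⟩ := hg
  refine ⟨fun t => F t + G t, hF.add hG, fun t => ?_⟩
  filter_upwards [hF' t, hG' t, Lp.coeFn_add (F t) (G t)] with ω h1 h2 h3
  rw [h3, Pi.add_apply, h1, h2]

theorem HasL1Curve.const_mul {Ω : Type*} [MeasurableSpace Ω] {P : Measure Ω} {f : ℝ → Ω → ℝ}
    (hf : HasL1Curve P f) (c : ℝ) : HasL1Curve P (fun t ω => c * f t ω) := by
  obtain ⟨F, hF, hF'⟩ := hf
  refine ⟨fun t => c • F t, hF.const_smul c, fun t => ?_⟩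
  filter_upwards [hF' t, Lp.coeFn_smul c (F t)] with ω h1 h3
  simp [h3, h1]

theorem HasL1Curve.rect {Ω : Type*} [MeasurableSpace Ω] (P : Measure Ω) [IsProbabilityMeasure P]
    {s : Set ℝ} (hs : MeasurableSet s) {u : Set Ω} (hu : MeasurableSet u) :
    HasL1Curve P (fun t ω => (s ×ˢ u).indicator (fun _ => (1:ℝ)) (t, ω)) := by
  refine ⟨s.indicator (fun _ => indicatorConstLp 1 hu (measure_ne_top P u) (1:ℝ)),
    stronglyMeasurable_const.indicator hs, fun t => ?_⟩
  by_cases ht : t ∈ s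
  · rw [Set.indicator_of_mem ht]
    filter_upwards [indicatorConstLp_coeFn (p := 1) (hs := hu) (hμs := measure_ne_top P u)
      (c := (1:ℝ))] with ω h
    rw [h]
    by_cases hω : ω ∈ u
    · rw [Set.indicator_of_mem hω, Set.indicator_of_mem (Set.mk_mem_prod ht hω)]
    · rw [Set.indicator_of_notMem hω, Set.indicator_of_notMem fun h => hω h.2]
  · rw [Set.indicator_of_notMem ht]
    filter_upwards [Lp.coeFn_zero ℝ 1 P] with ω h
    rw [h]
    simp [Set.indicator, ht]

theorem HasL1Curve.lim {Ω : Type*} [MeasurableSpace Ω] {P : Measure Ω} [IsProbabilityMeasure P]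
    {f : ℕ → ℝ → Ω → ℝ} {g : ℝ → Ω → ℝ} {C : ℝ}
    (hf : ∀ n, HasL1Curve P (f n)) (hb : ∀ n t ω, ‖f n t ω‖ ≤ C)
    (hl : ∀ t ω, Tendsto (fun n => f n t ω) atTop (𝓝 (g t ω))) : HasL1Curve P g := by
  choose F hF hF' using hf
  have hfm : ∀ n t, AEStronglyMeasurable (f n t) P := fun n t =>
    (Lp.aestronglyMeasurable (F n t)).congr (hF' n t)
  have hgm : ∀ t, AEStronglyMeasurable (g t) P := fun t =>
    aestronglyMeasurable_of_tendsto_ae atTop (fun n => hfm n t) (ae_of_all _ (hl t))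
  have hgb : ∀ t ω, ‖g t ω‖ ≤ C := fun t ω =>
    le_of_tendsto (hl t ω).norm (Eventually.of_forall fun n => hb n t ω)
  have hgL : ∀ t, MemLp (g t) 1 P := fun t =>
    MemLp.of_bound (hgm t) C (ae_of_all _ (hgb t))
  refine ⟨fun t => (hgL t).toLp (g t), ?_, fun t => (hgL t).coeFn_toLp⟩
  refine stronglyMeasurable_of_tendsto atTop hF ?_
  rw [tendsto_pi_nhds]
  intro t
  rw [Lp.tendsto_Lp_iff_tendsto_eLpNorm]
  have h := tendsto_lintegral_norm_of_dominated_convergence (μ := P) (F := fun n => f n t)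
    (f := g t) (bound := fun _ => C) (fun n => hfm n t) (hasFiniteIntegral_const C)
    (fun n => ae_of_all _ (hb n t)) (ae_of_all _ (hl t))
  refine h.congr fun n => ?_
  rw [eLpNorm_one_eq_lintegral_enorm]
  refine lintegral_congr_ae ?_
  filter_upwards [hF' n t] with ω h1
  simp only [Pi.sub_apply, h1, ofReal_norm]

theorem HasL1Curve.indicator {Ω : Type*} [MeasurableSpace Ω] (P : Measure Ω)
    [IsProbabilityMeasure P] {s : Set (ℝ × Ω)} (hs : MeasurableSet s) :
    HasL1Curve P (fun t ω => s.indicator (fun _ => (1:ℝ)) (t, ω)) := by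
  induction s, hs using MeasurableSpace.induction_on_inter generateFrom_prod.symm isPiSystem_prod
    with
  | empty => simpa using HasL1Curve.rect P (MeasurableSet.empty) (MeasurableSet.empty (α := Ω))
  | basic s hs =>
    obtain ⟨u, hu, v, hv, rfl⟩ := hs
    exact HasL1Curve.rect P hu hv
  | compl s hs ih =>
    have h := (HasL1Curve.rect P MeasurableSet.univ MeasurableSet.univ).add (ih.const_mul (-1))
    refine cast ?_ h
    congr 1
    ext t ω
    by_cases hx : (t, ω) ∈ s <;> simp [hx]
  | iUnion u hd hu ih =>
    have hfin : ∀ n : ℕ, HasL1Curve P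
        (fun t ω => (⋃ i ∈ Finset.range n, u i).indicator (fun _ => (1:ℝ)) (t, ω)) := by
      intro n
      induction n with
      | zero => simpa using HasL1Curve.rect P (MeasurableSet.empty) (MeasurableSet.empty (α := Ω))
      | succ n ihn =>
        refine cast ?_ (ihn.add (ih n))
        congr 1
        ext t ω
        rw [Finset.range_add_one, Finset.set_biUnion_insert, Set.union_comm,
          Set.indicator_union_of_disjoint]
        rw [Set.disjoint_iUnion₂_left]
        intro i hi
        exact hd (Finset.mem_range.1 hi).ne
    refine HasL1Curve.lim (C := 1) hfin (fun n t ω => ?_) (fun t ω => ?_)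
    · refine (norm_indicator_le_norm_self _ _).trans (by simp)
    · by_cases hx : (t, ω) ∈ ⋃ i, u i
      · rw [Set.indicator_of_mem hx]
        obtain ⟨i, hi⟩ := Set.mem_iUnion.1 hx
        refine tendsto_const_nhds.congr' ?_
        filter_upwards [eventually_gt_atTop i] with n hn
        rw [Set.indicator_of_mem]
        exact Set.mem_biUnion (Finset.mem_coe.2 (Finset.mem_range.2 hn)) hi
      · rw [Set.indicator_of_notMem hx]
        refine tendsto_const_nhds.congr fun n => ?_
        rw [Set.indicator_of_notMem]
        intro h
        obtain ⟨i, _, hi⟩ := Set.mem_iUnion₂.1 h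
        exact hx (Set.mem_iUnion.2 ⟨i, hi⟩)

theorem HasL1Curve.of_bounded {Ω : Type*} [MeasurableSpace Ω] (P : Measure Ω)
    [IsProbabilityMeasure P] {f : ℝ → Ω → ℝ} (hf : Measurable fun p : ℝ × Ω => f p.1 p.2)
    {C : ℝ} (hC : ∀ t ω, |f t ω| ≤ C) : HasL1Curve P f := by
  obtain ⟨ω₀⟩ : Nonempty Ω := P.nonempty_of_neZero
  have hC0 : 0 ≤ C := (abs_nonneg _).trans (hC 0 ω₀)
  have hS := hf.stronglyMeasurable
  have hsimple : ∀ φ : SimpleFunc (ℝ × Ω) ℝ, HasL1Curve P (fun t ω => φ (t, ω)) := by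
    intro φ
    induction φ using SimpleFunc.induction with
    | const c hs =>
      refine cast ?_ ((HasL1Curve.indicator P hs).const_mul c)
      congr 1
      ext t ω
      simp [Set.indicator, Set.piecewise]
    | add _ h1 h2 => exact h1.add h2
  exact HasL1Curve.lim (f := fun n t ω => hS.approxBounded C n (t, ω)) (C := C)
    (fun n => hsimple _) (fun n t ω => hS.norm_approxBounded_le hC0 n _)
    (fun t ω => hS.tendsto_approxBounded_of_norm_le (x := (t, ω)) (hC t ω))

theorem ae_nonneg_of_spike {Ω : Type*} [mΩ : MeasurableSpace Ω] (P : Measure Ω)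
    [IsProbabilityMeasure P] (F : Filtration ℝ mΩ) (T : ℝ)
    {f : ℝ → Ω → ℝ} (hf : Measurable fun p : ℝ × Ω => f p.1 p.2)
    {C : ℝ} (hC : ∀ t ω, |f t ω| ≤ C) (had : ∀ t, Measurable[F t] (f t))
    (hsp : ∀ θ ∈ Set.Ioo (0:ℝ) T, ∀ h > (0:ℝ), θ + h ≤ T →
      ∀ B : Set Ω, MeasurableSet[F θ] B →
      0 ≤ ∫ ω in B, (∫ t in Set.Ioc θ (θ + h), f t ω) ∂P) :
    ∀ᵐ t : ℝ, t ∈ Set.Ioo (0:ℝ) T → ∀ᵐ ω ∂P, 0 ≤ f t ω := by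
  obtain ⟨G, hG, hGf⟩ := HasL1Curve.of_bounded P hf hC
  have hGn : ∀ t, ‖G t‖ ≤ C := by
    intro t
    rw [L1.norm_eq_integral_norm]
    have : ∫ ω, ‖G t ω‖ ∂P ≤ ∫ ω, C ∂P := by
      refine integral_mono_ae (L1.integrable_coeFn _).norm (integrable_const _) ?_
      filter_upwards [hGf t] with ω h
      rw [h]
      exact hC t ω
    simpa using this
  have hGl : LocallyIntegrable G volume := by
    refine (locallyIntegrable_const C).mono hG.aestronglyMeasurable (ae_of_all _ fun t => ?_)
    exact (hGn t).trans (le_abs_self C)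
  filter_upwards [_root_.LocallyIntegrable.ae_hasDerivAt_integral hGl] with t ht htT
  set B : Set Ω := {ω | f t ω < 0} with hB
  have hBF : MeasurableSet[F t] B := measurableSet_lt (had t) measurable_const
  have hBm : MeasurableSet B := F.le t _ hBF
  let L : Lp ℝ 1 P →L[ℝ] ℝ :=
    (L1.integralCLM (E := ℝ) (μ := P.restrict B)).comp (LpToLpRestrictCLM Ω ℝ ℝ P 1 B)
  have hL : ∀ s, L (G s) = ∫ ω in B, f s ω ∂P := by
    intro s
    have : L (G s) = ∫ ω, (LpToLpRestrictCLM Ω ℝ ℝ P 1 B (G s)) ω ∂(P.restrict B) := by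
      rw [← L1.integral_eq_integral, L1.integral_eq]
      rfl
    rw [this]
    refine integral_congr_ae ?_
    filter_upwards [LpToLpRestrictCLM_coeFn ℝ B (G s), ae_restrict_of_ae (hGf s)] with ω h1 h2
    rw [h1, h2]
  have hD : HasDerivAt (fun u => L (∫ s in t..u, G s)) (L (G t)) t :=
    L.hasFDerivAt.comp_hasDerivAt t (ht t)
  have hGint : ∀ u, IntervalIntegrable G volume t u := fun u =>
    intervalIntegrable_iff.mpr <|
      (hGl.integrableOn_isCompact isCompact_uIcc).mono_set Set.uIoc_subset_uIcc
  have hval : ∀ u ∈ Set.Ioo t T, 0 ≤ L (∫ s in t..u, G s) := by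
    intro u hu
    rw [← L.intervalIntegral_comp_comm (hGint u), intervalIntegral.integral_of_le hu.1.le]
    simp_rw [hL]
    rw [integral_integral_swap]
    · have := hsp t htT (u - t) (sub_pos.2 hu.1) (by linarith [hu.2]) B hBF
      simpa using this
    · refine Integrable.of_bound (C := C) hf.aestronglyMeasurable (ae_of_all _ fun p => hC _ _)
  have hnn : 0 ≤ L (G t) := by
    have hs := (hasDerivWithinAt_iff_tendsto_slope' (by simp)).1
      (hD.hasDerivWithinAt (s := Set.Ioi t))
    refine ge_of_tendsto hs ?_
    filter_upwards [Ioo_mem_nhdsGT htT.2] with u hu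
    rw [slope_def_field]
    have := hval u hu
    simp only [intervalIntegral.integral_same, map_zero, sub_zero]
    exact div_nonneg this (sub_nonneg.2 hu.1.le)
  rw [hL] at hnn
  have hfi : Integrable (f t) P :=
    Integrable.of_bound (C := C) (hf.comp measurable_prodMk_left).aestronglyMeasurable
      (ae_of_all _ fun ω => hC t ω)
  have hpos : 0 ≤ᵐ[P.restrict B] fun ω => - f t ω := by
    filter_upwards [ae_restrict_mem hBm] with ω hω
    have : f t ω < 0 := hω
    simp only [Pi.zero_apply]
    linarith
  have hz : ∫ ω in B, - f t ω ∂P = 0 := by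
    refine le_antisymm ?_ (integral_nonneg_of_ae hpos)
    rw [integral_neg]
    linarith
  have h0 := (setIntegral_eq_zero_iff_of_nonneg_ae hpos hfi.neg.integrableOn).1 hz
  filter_upwards [(ae_restrict_iff' hBm).1 h0] with ω hω
  by_contra hcon
  have hlt : f t ω < 0 := not_le.1 hcon
  have := hω hlt
  simp only [Pi.zero_apply] at this
  linarith

/-- abstract form of Corollary 4.9, pointwise maximization from spike
variations: let g(t,ω,a) be bounded, jointly measurable, continuous in a, with
ω ↦ g(t,ω,a) F_t-measurable, and let μ = κ be a Markov kernel from [0,T] × Ω to A such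
that ω ↦ ∫_A g(t,ω,a) κ(t,ω)(da) is F_t-measurable. If for all θ ∈ (0,T), h > 0 with
θ + h ≤ T, B ∈ F_θ and Borel probability measures ν on A,
E[1_B ∫_θ^{θ+h} (∫_A g dκ(t,·) − ∫_A g dν) dt] ≥ 0, then for Lebesgue-a.e. t ∈ [0,T],
P-a.s., ∫_A g(t,ω,a) κ(t,ω)(da) = sup_{a ∈ A} g(t,ω,a); equivalently
∫_A g(t,ω,a) κ(t,ω)(da) ≥ ∫_A g(t,ω,a) ν(da) for every Borel probability measure ν. -/
theorem pointwise_maximization_from_spike_variations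
    {A : Type*} [MetricSpace A] [CompactSpace A] [Nonempty A]
    [MeasurableSpace A] [BorelSpace A]
    {Ω : Type*} [mΩ : MeasurableSpace Ω]
    (T : ℝ) (hT : 0 < T)
    (P : Measure Ω) [IsProbabilityMeasure P]
    (F : Filtration ℝ mΩ)
    (g : ℝ → Ω → A → ℝ)
    (hgm : Measurable fun p : ℝ × Ω × A => g p.1 p.2.1 p.2.2)
    (hgb : ∃ C, ∀ t ω a, |g t ω a| ≤ C)
    (hgc : ∀ t ω, Continuous (g t ω))
    (hgad : ∀ t a, Measurable[F t] fun ω => g t ω a)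
    (κ : Kernel (ℝ × Ω) A) [IsMarkovKernel κ]
    (hκad : ∀ t, Measurable[F t] fun ω => ∫ a, g t ω a ∂(κ (t, ω)))
    (hspike : ∀ θ ∈ Set.Ioo (0:ℝ) T, ∀ h > (0:ℝ), θ + h ≤ T →
      ∀ B : Set Ω, MeasurableSet[F θ] B →
      ∀ ν : Measure A, IsProbabilityMeasure ν →
      0 ≤ ∫ ω in B, (∫ t in Set.Ioc θ (θ + h),
          ((∫ a, g t ω a ∂(κ (t, ω))) - ∫ a, g t ω a ∂ν)) ∂P) :
    ∀ᵐ t ∂(volume.restrict (Set.Icc (0:ℝ) T)), ∀ᵐ ω ∂P,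
      ((∫ a, g t ω a ∂(κ (t, ω))) = ⨆ a : A, g t ω a) ∧
      ∀ ν : Measure A, IsProbabilityMeasure ν →
        (∫ a, g t ω a ∂ν) ≤ ∫ a, g t ω a ∂(κ (t, ω)) := by
  obtain ⟨C, hC⟩ := hgb
  have hKm : Measurable fun p : ℝ × Ω => ∫ a, g p.1 p.2 a ∂(κ p) := by
    have h : StronglyMeasurable fun q : (ℝ × Ω) × A => g q.1.1 q.1.2 q.2 :=
      (hgm.comp (measurable_fst.fst.prodMk (measurable_fst.snd.prodMk
        measurable_snd))).stronglyMeasurable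
    exact (h.integral_kernel_prod_right' (κ := κ)).measurable
  have hgi : ∀ t ω (ν : Measure A), IsProbabilityMeasure ν → Integrable (g t ω) ν :=
    fun t ω ν _ => Integrable.of_bound (C := C) (hgc t ω).measurable.aestronglyMeasurable
      (ae_of_all _ fun a => hC t ω a)
  have hKb : ∀ t ω, |∫ a, g t ω a ∂(κ (t, ω))| ≤ C := fun t ω => by
    have := norm_integral_le_of_norm_le_const (μ := κ (t, ω)) (f := g t ω) (C := C)
      (ae_of_all _ fun a => hC t ω a)
    simpa using this
  have key : ∀ a : A, ∀ᵐ t : ℝ, t ∈ Set.Ioo (0:ℝ) T → ∀ᵐ ω ∂P,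
      0 ≤ (∫ b, g t ω b ∂(κ (t, ω))) - g t ω a := by
    intro a
    refine ae_nonneg_of_spike P F T (C := C + C)
      (f := fun t ω => (∫ b, g t ω b ∂(κ (t, ω))) - g t ω a) ?_ ?_ ?_ ?_
    · exact hKm.sub (hgm.comp (measurable_fst.prodMk (measurable_snd.prodMk measurable_const)))
    · exact fun t ω => (abs_sub _ _).trans (add_le_add (hKb t ω) (hC t ω a))
    · exact fun t => (hκad t).sub (hgad t a)
    · intro θ hθ h hh hle B hB
      have := hspike θ hθ h hh hle B hB (Measure.dirac a) inferInstance
      simpa only [integral_dirac] using this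
  obtain ⟨D, hDc, hDd⟩ := TopologicalSpace.exists_countable_dense A
  have hall : ∀ᵐ t : ℝ, t ∈ Set.Ioo (0:ℝ) T → ∀ᵐ ω ∂P, ∀ a ∈ D,
      0 ≤ (∫ b, g t ω b ∂(κ (t, ω))) - g t ω a := by
    filter_upwards [(ae_ball_iff hDc).2 fun a _ => key a] with t ht htT
    exact (ae_ball_iff hDc).2 fun a ha => ht a ha htT
  rw [← Measure.restrict_congr_set Ioo_ae_eq_Icc]
  refine (ae_restrict_iff' measurableSet_Ioo).2 ?_
  filter_upwards [hall] with t ht htT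
  filter_upwards [ht htT] with ω hω
  have hle : ∀ a, g t ω a ≤ ∫ b, g t ω b ∂(κ (t, ω)) := by
    intro a
    have hcl : IsClosed {a | g t ω a ≤ ∫ b, g t ω b ∂(κ (t, ω))} :=
      isClosed_le (hgc t ω) continuous_const
    have hsub : closure D ⊆ {a | g t ω a ≤ ∫ b, g t ω b ∂(κ (t, ω))} :=
      closure_minimal (fun a ha => sub_nonneg.1 (hω a ha)) hcl
    exact hsub (hDd a)
  have hbd : BddAbove (Set.range (g t ω)) := ⟨_, by rintro _ ⟨a, rfl⟩; exact hle a⟩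
  refine ⟨le_antisymm ?_ (ciSup_le hle), fun ν hν => ?_⟩
  · have := integral_mono (hgi t ω (κ (t, ω)) inferInstance)
      (integrable_const (⨆ a : A, g t ω a)) (fun a => le_ciSup hbd a)
    simpa using this
  · have := integral_mono (hgi t ω ν hν)
      (integrable_const (∫ b, g t ω b ∂(κ (t, ω)))) hle
    simpa using this
end
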